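/- arXiv:1212.6843 — 3 statements merged into one kernel-verified Lean document; each statement's English description precedes it below -/
import Mathlib

section
/- Let K_1, …, K_r ⊆ ℝⁿ be nonempty closed convex sets, K := ⋂_{l=1}^r K_l, and x̄ ∈ K. Assume: whenever v_l ∈ N_{K_l}(x̄) for l = 1,…,r and Σ_{l=1}^r v_l = 0, then v_l = 0 for all l. Then there exists P ∈ ℕ such that for every integer p̄ ≥ P the following holds: if (x_i) is generated by the mass projection algorithm with memory p̄ — i.e. for i ≥ 1 and j ∈ {1,…,r}: x_i^{(j)} = P_{K_j}(x_{i−1}), a_i^{(j)} = x_{i−1} − x_i^{(j)}, b_i^{(j)} = ⟪a_i^{(j)}, x_i^{(j)}⟫, F̃_i = {x : ⟪a_l^{(j)}, x⟫ ≤ b_l^{(j)} for 1 ≤ j ≤ r and max(1, i−p̄) ≤ l ≤ i}, x_i = P_{F̃_i}(x_{i−1}) — and (x_i) converges to x̄ with x_i ≠ x̄ for all i, then lim_{i→∞} ‖x_{i+p̄} − x̄‖ / ‖x_i − x̄‖ = 0. -/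
open scoped RealInnerProductSpace
open Filter Topology

/-- The normal cone of a convex set `C` at a point `x ∈ C`. -/
def normalCone {E : Type*} [NormedAddCommGroup E] [InnerProductSpace ℝ E]
    (C : Set E) (x : E) : Set E :=
  {v | ∀ y ∈ C, ⟪v, y - x⟫ ≤ 0}

section Auxiliary

variable {E : Type*} [NormedAddCommGroup E] [InnerProductSpace ℝ E]

theorem mem_normalCone_of_tendsto {ι : Type*} {l : Filter ι} [l.NeBot] {C : Set E}
    {p v : ι → E} {p₀ v₀ : E} (hp : Tendsto p l (𝓝 p₀)) (hv : Tendsto v l (𝓝 v₀))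
    (h : ∀ i, v i ∈ normalCone C (p i)) : v₀ ∈ normalCone C p₀ := fun z hz =>
  le_of_tendsto' (hv.inner (tendsto_const_nhds.sub hp)) fun i => h i z hz

theorem smul_mem_normalCone {C : Set E} {p v : E} {t : ℝ} (ht : 0 ≤ t)
    (hv : v ∈ normalCone C p) : t • v ∈ normalCone C p := fun z hz => by
  rw [real_inner_smul_left]
  exact mul_nonpos_of_nonneg_of_nonpos ht (hv z hz)

/-- A point `p ∈ C` with `y - p` normal to `C` at `p` is a nearest point. -/
theorem infDist_eq_norm_sub_of_mem_normalCone {C : Set E} (hC : Convex ℝ C) {y p : E}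
    (hp : p ∈ C) (h : y - p ∈ normalCone C p) : Metric.infDist y C = ‖y - p‖ := by
  rw [Metric.infDist_eq_iInf, (norm_eq_iInf_iff_real_inner_le_zero hC hp).2 h]
  simp [dist_eq_norm]

theorem exists_mem_sub_mem_normalCone [CompleteSpace E] {C : Set E} (hne : C.Nonempty)
    (hcl : IsClosed C) (hcv : Convex ℝ C) (y : E) : ∃ p ∈ C, y - p ∈ normalCone C p := by
  obtain ⟨p, hp, h⟩ := exists_norm_eq_iInf_of_complete_convex hne hcl.isComplete hcv y
  exact ⟨p, hp, (norm_eq_iInf_iff_real_inner_le_zero hcv hp).1 h⟩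

/-- Projecting does not increase the distance to points of the set. -/
theorem norm_sub_le_of_inner_nonpos {y p z : E} (h : ⟪y - p, z - p⟫ ≤ 0) :
    ‖p - z‖ ≤ ‖y - z‖ := by
  have h1 : ‖y - z‖ ^ 2 = ‖y - p‖ ^ 2 - 2 * ⟪y - p, z - p⟫ + ‖p - z‖ ^ 2 := by
    rw [norm_sub_rev p z, ← norm_sub_sq_real]
    congr 2
    abel
  exact le_of_sq_le_sq (by nlinarith [sq_nonneg ‖y - p‖]) (norm_nonneg _)

/-- Supporting hyperplanes of `C` at points near `q` pass close to `q`. -/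
theorem exists_inner_le_of_mem_normalCone [FiniteDimensional ℝ E] {C : Set E} (q : E)
    {ε : ℝ} (hε : 0 < ε) :
    ∃ δ > 0, ∀ y ∈ C, ‖y - q‖ < δ → ∀ v ∈ normalCone C y,
      ⟪v, y - q⟫ ≤ ε * (‖v‖ * ‖y - q‖) := by
  by_contra! H
  choose y hyC hyq v hv hlt using fun m : ℕ => H (1 / (m + 1)) Nat.one_div_pos_of_nat
  have hylim : Tendsto y atTop (𝓝 q) := by
    rw [tendsto_iff_norm_sub_tendsto_zero]
    exact squeeze_zero (fun _ => norm_nonneg _) (fun m => (hyq m).le)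
      tendsto_one_div_add_atTop_nhds_zero_nat
  have hv0 : ∀ m, 0 < ‖v m‖ := fun m => norm_pos_iff.2 fun h0 => by
    simpa [h0] using hlt m
  have hy0 : ∀ m, 0 < ‖y m - q‖ := fun m => norm_pos_iff.2 fun h0 => by
    simpa [h0] using hlt m
  have hmem : ∀ m, (‖v m‖⁻¹ • v m, ‖y m - q‖⁻¹ • (y m - q)) ∈
      Metric.closedBall (0 : E) 1 ×ˢ Metric.closedBall (0 : E) 1 := fun m => by
    simp [norm_smul, (hv0 m).ne', (hy0 m).ne']
  obtain ⟨⟨w, d⟩, -, φ, hφ, hlim⟩ :=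
    ((isCompact_closedBall (0 : E) 1).prod (isCompact_closedBall (0 : E) 1)).tendsto_subseq hmem
  have hw := (continuous_fst.tendsto (w, d)).comp hlim
  have hd := (continuous_snd.tendsto (w, d)).comp hlim
  have hwN : w ∈ normalCone C q :=
    mem_normalCone_of_tendsto (hylim.comp hφ.tendsto_atTop) hw fun m =>
      smul_mem_normalCone (inv_nonneg.2 (norm_nonneg _)) (hv _)
  have hge : ε ≤ ⟪w, d⟫ := ge_of_tendsto' (hw.inner hd) fun m => by
    simp only [Function.comp_apply, real_inner_smul_left, real_inner_smul_right]
    rw [← mul_assoc, ← mul_inv, inv_mul_eq_div, mul_comm ‖y _ - q‖,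
      le_div_iff₀ (mul_pos (hv0 _) (hy0 _))]
    exact (hlt _).le
  have hle : ⟪w, d⟫ ≤ 0 := le_of_tendsto' (tendsto_const_nhds.inner hd) fun m => by
    simp only [Function.comp_apply, real_inner_smul_right]
    exact mul_nonpos_of_nonneg_of_nonpos (inv_nonneg.2 (norm_nonneg _)) (hwN _ (hyC _))
  linarith

/-- The qualification condition at `q`, made quantitative and uniform near `q`. -/
theorem exists_mul_norm_le_norm_sum_normals [FiniteDimensional ℝ E] {r : ℕ}
    {K : Fin r → Set E} {q : E}
    (hcond : ∀ v : Fin r → E, (∀ l, v l ∈ normalCone (K l) q) → ∑ l, v l = 0 → ∀ l, v l = 0) :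
    ∃ β > 0, ∃ δ > 0, ∀ p v : Fin r → E, (∀ j, ‖p j - q‖ < δ) →
      (∀ j, v j ∈ normalCone (K j) (p j)) → β * ‖v‖ ≤ ‖∑ j, v j‖ := by
  by_contra! H
  choose p v hpq hv hlt using fun m : ℕ =>
    H (1 / (m + 1)) Nat.one_div_pos_of_nat (1 / (m + 1)) Nat.one_div_pos_of_nat
  have hplim : ∀ j, Tendsto (fun m => p m j) atTop (𝓝 q) := fun j => by
    rw [tendsto_iff_norm_sub_tendsto_zero]
    exact squeeze_zero (fun _ => norm_nonneg _) (fun m => (hpq m j).le)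
      tendsto_one_div_add_atTop_nhds_zero_nat
  have hv0 : ∀ m, 0 < ‖v m‖ := fun m => norm_pos_iff.2 fun h0 => by
    simpa [h0] using hlt m
  have hmem : ∀ m, ‖v m‖⁻¹ • v m ∈ Metric.sphere (0 : Fin r → E) 1 := fun m => by
    simp [norm_smul, (hv0 m).ne']
  obtain ⟨w, hw1, φ, hφ, hw⟩ := (isCompact_sphere (0 : Fin r → E) 1).tendsto_subseq hmem
  have hwj := fun j => (tendsto_pi_nhds.1 hw) j
  have hwN : ∀ j, w j ∈ normalCone (K j) q := fun j =>
    mem_normalCone_of_tendsto ((hplim j).comp hφ.tendsto_atTop) (hwj j) fun m =>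
      smul_mem_normalCone (inv_nonneg.2 (norm_nonneg _)) (hv _ j)
  have hsum : Tendsto (fun m => ∑ j, (‖v (φ m)‖⁻¹ • v (φ m)) j) atTop (𝓝 (∑ j, w j)) :=
    tendsto_finsetSum _ fun j _ => hwj j
  have hsum0 : Tendsto (fun m => ∑ j, (‖v (φ m)‖⁻¹ • v (φ m)) j) atTop (𝓝 0) := by
    refine squeeze_zero_norm (fun m => ?_)
      (tendsto_one_div_add_atTop_nhds_zero_nat.comp hφ.tendsto_atTop)
    simp only [Pi.smul_apply, ← Finset.smul_sum, norm_smul, norm_inv, norm_norm]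
    rw [inv_mul_le_iff₀ (hv0 _), mul_comm]
    exact (hlt _).le
  have hw0 : w = 0 := funext (hcond w hwN (tendsto_nhds_unique hsum hsum0))
  simp [hw0] at hw1

/-- Linear regularity of `K` near `q`. -/
theorem exists_norm_sub_le_infDist [FiniteDimensional ℝ E] {r : ℕ} (hr : 1 ≤ r)
    {K : Fin r → Set E} (hKcl : ∀ j, IsClosed (K j)) (hKcv : ∀ j, Convex ℝ (K j))
    {q : E} (hq : ∀ j, q ∈ K j)
    (hcond : ∀ v : Fin r → E, (∀ l, v l ∈ normalCone (K l) q) → ∑ l, v l = 0 → ∀ l, v l = 0) :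
    ∃ κ > 0, ∃ δ > 0, ∀ x, ‖x - q‖ < δ → ∃ y, (∀ j, y ∈ K j) ∧
      ∃ j, ‖x - y‖ ≤ κ * Metric.infDist x (K j) := by
  have : Nonempty (Fin r) := ⟨⟨0, hr⟩⟩
  have : ProperSpace E := FiniteDimensional.proper ℝ E
  have hr0 : (0 : ℝ) < r := by exact_mod_cast hr
  have hr1 : (1 : ℝ) ≤ r := by exact_mod_cast hr
  obtain ⟨β, hβ, δ, hδ, hreg⟩ := exists_mul_norm_le_norm_sum_normals hcond
  set f : E → ℝ := fun y => ∑ j, Metric.infDist y (K j) ^ 2 with hf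
  have hf0 : ∀ y, 0 ≤ f y := fun y => Finset.sum_nonneg fun _ _ => sq_nonneg _
  have hfcont : Continuous f := continuous_finsetSum _ fun j _ =>
    (Metric.continuous_infDist_pt (K j)).pow 2
  have hfle : ∀ y t, (∀ j, Metric.infDist y (K j) ≤ t) → √(f y) ≤ r * t := fun y t ht => by
    have ht0 : 0 ≤ t := Metric.infDist_nonneg.trans (ht ⟨0, hr⟩)
    refine Real.sqrt_le_iff.2 ⟨by positivity, ?_⟩
    calc f y ≤ ∑ _j : Fin r, t ^ 2 :=
          Finset.sum_le_sum fun j _ => pow_le_pow_left₀ Metric.infDist_nonneg (ht j) 2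
      _ = r * t ^ 2 := by simp
      _ ≤ (r * t) ^ 2 := by nlinarith [mul_nonneg hr0.le (sq_nonneg t)]
  set γ : ℝ := β ^ 2 / r ^ 2 with hγ
  have hγ0 : 0 < γ := by positivity
  -- one step of averaged projections
  have hstep : ∀ y, ‖y - q‖ < δ → ∃ y', f y' ≤ (1 - γ) * f y ∧ ‖y' - y‖ ≤ √(f y) := by
    intro y hy
    choose p hpK hpN using fun j =>
      exists_mem_sub_mem_normalCone ⟨q, hq j⟩ (hKcl j) (hKcv j) y
    have hd : ∀ j, Metric.infDist y (K j) = ‖y - p j‖ := fun j =>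
      infDist_eq_norm_sub_of_mem_normalCone (hKcv j) (hpK j) (hpN j)
    set v : Fin r → E := fun j => y - p j with hvdef
    set g : E := ∑ j, v j with hg
    have hfy : f y = ∑ j, ‖v j‖ ^ 2 := by simp only [hf, hd, hvdef]
    have hgv : β * ‖v‖ ≤ ‖g‖ := hreg p v
      (fun j => (norm_sub_le_of_inner_nonpos (hpN j q (hq j))).trans_lt hy) hpN
    have hfv : f y ≤ r * ‖v‖ ^ 2 := by
      rw [hfy]
      calc ∑ j, ‖v j‖ ^ 2 ≤ ∑ _j : Fin r, ‖v‖ ^ 2 :=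
            Finset.sum_le_sum fun j _ => pow_le_pow_left₀ (norm_nonneg _) (norm_le_pi_norm v j) 2
        _ = r * ‖v‖ ^ 2 := by simp
    have hvf : ‖v‖ ≤ √(f y) := (pi_norm_le_iff_of_nonneg (Real.sqrt_nonneg _)).2 fun j => by
      refine Real.le_sqrt_of_sq_le ?_
      rw [hfy]
      exact Finset.single_le_sum (f := fun j => ‖v j‖ ^ 2) (fun _ _ => sq_nonneg _)
        (Finset.mem_univ j)
    refine ⟨y - (r : ℝ)⁻¹ • g, ?_, ?_⟩
    · have h1 : f (y - (r : ℝ)⁻¹ • g) ≤ f y - ‖g‖ ^ 2 / r := by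
        calc f (y - (r : ℝ)⁻¹ • g) ≤ ∑ j, ‖v j - (r : ℝ)⁻¹ • g‖ ^ 2 := by
              refine Finset.sum_le_sum fun j _ => pow_le_pow_left₀ Metric.infDist_nonneg ?_ 2
              refine (Metric.infDist_le_dist_of_mem (hpK j)).trans_eq ?_
              rw [dist_eq_norm]
              congr 1
              simp only [hvdef]
              abel
          _ = ∑ j, (‖v j‖ ^ 2 - 2 * (r : ℝ)⁻¹ * ⟪v j, g⟫ + ((r : ℝ)⁻¹ * ‖g‖) ^ 2) := by
              refine Finset.sum_congr rfl fun j _ => ?_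
              rw [norm_sub_sq_real, real_inner_smul_right, norm_smul, Real.norm_of_nonneg
                (inv_nonneg.2 hr0.le)]
              ring
          _ = f y - 2 * (r : ℝ)⁻¹ * ‖g‖ ^ 2 + r * ((r : ℝ)⁻¹ * ‖g‖) ^ 2 := by
              rw [Finset.sum_add_distrib, Finset.sum_sub_distrib, ← Finset.mul_sum,
                ← sum_inner, ← hg, real_inner_self_eq_norm_sq, hfy]
              simp
          _ = f y - ‖g‖ ^ 2 / r := by
              field_simp
              ring
      have h2 : γ * f y ≤ ‖g‖ ^ 2 / r := by
        rw [hγ, div_mul_eq_mul_div, div_le_div_iff₀ (by positivity) hr0]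
        have h3 : (β * ‖v‖) ^ 2 ≤ ‖g‖ ^ 2 := pow_le_pow_left₀ (by positivity) hgv 2
        calc β ^ 2 * f y * r ≤ β ^ 2 * (r * ‖v‖ ^ 2) * r := by gcongr
          _ = (β * ‖v‖) ^ 2 * r ^ 2 := by ring
          _ ≤ ‖g‖ ^ 2 * r ^ 2 := by gcongr
      linarith
    · have h1 : ‖g‖ ≤ r * ‖v‖ := by
        calc ‖g‖ ≤ ∑ j, ‖v j‖ := norm_sum_le _ _
          _ ≤ ∑ _j : Fin r, ‖v‖ := Finset.sum_le_sum fun j _ => norm_le_pi_norm v j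
          _ = r * ‖v‖ := by simp
      rw [sub_sub_cancel_left, norm_neg, norm_smul, norm_inv, Real.norm_of_nonneg hr0.le,
        inv_mul_le_iff₀ hr0]
      exact h1.trans (by gcongr)
  set η : ℝ := γ / 4 with hη
  have hη0 : 0 < η := by positivity
  refine ⟨r / η, by positivity, δ / (1 + r / η), by positivity, fun x hx => ?_⟩
  obtain ⟨y, hy⟩ : ∃ y, ∀ z, √(f y) + η * dist y x ≤ √(f z) + η * dist z x := by
    refine Continuous.exists_forall_le (f := fun z => √(f z) + η * dist z x) (by fun_prop) ?_
    exact tendsto_atTop_mono (fun z => le_add_of_nonneg_left (Real.sqrt_nonneg _))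
      ((tendsto_dist_right_cocompact_atTop x).const_mul_atTop hη0)
  obtain ⟨j, hj⟩ := Finite.exists_max fun j => Metric.infDist x (K j)
  have hyx : ‖x - y‖ ≤ r / η * Metric.infDist x (K j) := by
    have h1 := hy x
    rw [dist_self, mul_zero, add_zero, dist_comm, dist_eq_norm] at h1
    rw [div_mul_eq_mul_div, le_div_iff₀ hη0, mul_comm]
    linarith [Real.sqrt_nonneg (f y), hfle x _ hj]
  have hyq : ‖y - q‖ < δ := by
    have h1 : Metric.infDist x (K j) ≤ ‖x - q‖ := by
      rw [← dist_eq_norm]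
      exact Metric.infDist_le_dist_of_mem (hq j)
    have h2 : r / η * Metric.infDist x (K j) ≤ r / η * ‖x - q‖ := by gcongr
    have h3 : ‖y - q‖ ≤ ‖x - y‖ + ‖x - q‖ := by
      rw [norm_sub_rev x y]
      exact norm_sub_le_norm_sub_add_norm_sub y x q
    rw [lt_div_iff₀ (by positivity)] at hx
    linarith
  have hfy : f y = 0 := by
    by_contra hne
    have hpos : 0 < f y := lt_of_le_of_ne (hf0 y) (Ne.symm hne)
    obtain ⟨y', h1, h2⟩ := hstep y hyq
    have hs : 0 < √(f y) := Real.sqrt_pos.2 hpos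
    have hγ1 : 0 ≤ 1 - γ := nonneg_of_mul_nonneg_left ((hf0 y').trans h1) hpos
    have h3 : √(f y') ≤ (1 - γ / 2) * √(f y) := by
      refine Real.sqrt_le_iff.2 ⟨mul_nonneg (by linarith) hs.le, ?_⟩
      rw [mul_pow, Real.sq_sqrt hpos.le]
      nlinarith [mul_nonneg hpos.le (sq_nonneg γ)]
    have h4 : dist y' x ≤ √(f y) + dist y x := by
      refine (dist_triangle y' y x).trans ?_
      rw [dist_eq_norm y' y]
      linarith
    have h5 := hy y'
    nlinarith
  refine ⟨y, fun j => ?_, j, hyx⟩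
  have h1 := (Finset.sum_eq_zero_iff_of_nonneg fun _ _ => sq_nonneg _).1 hfy j (Finset.mem_univ j)
  exact ((hKcl j).mem_iff_infDist_zero ⟨q, hq j⟩).2 (pow_eq_zero_iff two_ne_zero |>.1 h1)

/-- Separated families of unit vectors have bounded cardinality. -/
theorem exists_forall_le_exists_norm_sub_lt [FiniteDimensional ℝ E] {s : ℝ} (hs : 0 < s) :
    ∃ P : ℕ, ∀ N, P ≤ N → ∀ u : ℕ → E, (∀ k < N, ‖u k‖ = 1) →
      ∃ l k, l < k ∧ k < N ∧ ‖u k - u l‖ < s := by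
  have : ProperSpace E := FiniteDimensional.proper ℝ E
  obtain ⟨t, -, htf, hcov⟩ := (isCompact_sphere (0 : E) 1).finite_cover_balls (half_pos hs)
  refine ⟨htf.toFinset.card + 1, fun N hN u hu => ?_⟩
  have hc : ∀ k, ∃ c, k < N → c ∈ t ∧ dist (u k) c < s / 2 := fun k => by
    by_cases hk : k < N
    · have h1 := hcov (mem_sphere_zero_iff_norm.2 (hu k hk))
      simp only [Set.mem_iUnion, Metric.mem_ball, exists_prop] at h1
      obtain ⟨c, hc⟩ := h1
      exact ⟨c, fun _ => hc⟩
    · exact ⟨0, fun h => absurd h hk⟩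
  choose c hc using hc
  obtain ⟨l, hl, k, hk, hne, heq⟩ := Finset.exists_ne_map_eq_of_card_lt_of_maps_to
    (s := Finset.range N) (t := htf.toFinset) (f := c) (by simpa using hN)
    (fun k hk => by simpa using (hc k (Finset.mem_range.1 hk)).1)
  rw [Finset.mem_range] at hl hk
  have hd : dist (u k) (u l) < s := by
    have h1 := (hc k hk).2
    have h2 := (hc l hl).2
    rw [← heq] at h1
    linarith [dist_triangle_right (u k) (u l) (c l)]
  rcases lt_or_gt_of_ne hne with h | h
  · exact ⟨l, k, h, hk, by rwa [← dist_eq_norm]⟩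
  · exact ⟨k, l, h, hl, by rwa [← dist_eq_norm, dist_comm]⟩

/-- A cut with unit normal `u` that contains `w` up to an error `e`, together with a direction
`u'` that still sees `w`, forces `u` and `u'` apart. -/
theorem le_norm_sub_of_inner_le {u u' w : E} {a e : ℝ} (hw : 0 < ‖w‖)
    (h : ⟪u, w⟫ ≤ e * ‖w‖) (h' : a * ‖w‖ ≤ ⟪u', w⟫) : a - e ≤ ‖u' - u‖ := by
  have h1 := real_inner_le_norm (u' - u) w
  rw [inner_sub_left] at h1
  exact le_of_mul_le_mul_right (by linarith) hw

end Auxiliary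

/-- Superlinear convergence of the mass projection algorithm
(Algorithm 5.1 / Theorem 5.12): under the normal cone alignment condition at `x̄`,
for all sufficiently large memory `p̄`, any convergent instance of the algorithm
satisfies `‖x_{i+p̄} − x̄‖ / ‖x_i − x̄‖ → 0`. -/
theorem superlinear_convergence_mass_projection
    {n : ℕ} {r : ℕ} (hr : 1 ≤ r)
    (K : Fin r → Set (EuclideanSpace ℝ (Fin n)))
    (hKne : ∀ j, (K j).Nonempty) (hKcl : ∀ j, IsClosed (K j))
    (hKcv : ∀ j, Convex ℝ (K j))
    (xbar : EuclideanSpace ℝ (Fin n)) (hxbar : xbar ∈ ⋂ j, K j)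
    -- alignment condition on the normal cones at `x̄`
    (hcond : ∀ v : Fin r → EuclideanSpace ℝ (Fin n),
      (∀ l, v l ∈ normalCone (K l) xbar) → ∑ l, v l = 0 → ∀ l, v l = 0) :
    ∃ P : ℕ, ∀ pbar : ℕ, P ≤ pbar →
      ∀ (x : ℕ → EuclideanSpace ℝ (Fin n))
        (xp : ℕ → Fin r → EuclideanSpace ℝ (Fin n)),
        -- `xp i j = P_{K j}(x (i-1))`
        (∀ i, 1 ≤ i → ∀ j, xp i j ∈ K j ∧
          ∀ z ∈ K j, ⟪x (i - 1) - xp i j, z - xp i j⟫ ≤ 0) →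
        -- `x i = P_{F̃ i}(x (i-1))` where
        -- `F̃ i = {y | ⟪a l j, y⟫ ≤ b l j for max(1, i−p̄) ≤ l ≤ i, 1 ≤ j ≤ r}`
        (∀ i, 1 ≤ i →
          (∀ l, max 1 (i - pbar) ≤ l → l ≤ i → ∀ j,
            ⟪x (l - 1) - xp l j, x i⟫ ≤ ⟪x (l - 1) - xp l j, xp l j⟫) ∧
          ∀ z : EuclideanSpace ℝ (Fin n),
            (∀ l, max 1 (i - pbar) ≤ l → l ≤ i → ∀ j,
              ⟪x (l - 1) - xp l j, z⟫ ≤ ⟪x (l - 1) - xp l j, xp l j⟫) →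
            ⟪x (i - 1) - x i, z - x i⟫ ≤ 0) →
        Tendsto x atTop (𝓝 xbar) →
        (∀ i, x i ≠ xbar) →
        Tendsto (fun i => ‖x (i + pbar) - xbar‖ / ‖x i - xbar‖) atTop (𝓝 0) := by
  have : Nonempty (Fin r) := ⟨⟨0, hr⟩⟩
  have hq : ∀ j, xbar ∈ K j := Set.mem_iInter.1 hxbar
  obtain ⟨κ, hκ, δ, hδ, hreg⟩ := exists_norm_sub_le_infDist hr hKcl hKcv hq hcond
  set C : ℝ := 2 * κ with hC
  have hC0 : 0 < C := by positivity
  obtain ⟨P, hP⟩ := exists_forall_le_exists_norm_sub_lt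
    (E := EuclideanSpace ℝ (Fin n)) (s := C⁻¹ / 2) (by positivity)
  refine ⟨P, fun pbar hpbar x xp hxp hx hlim hne => ?_⟩
  have hpos : ∀ i, 0 < ‖x i - xbar‖ := fun i => norm_pos_iff.2 (sub_ne_zero.2 (hne i))
  have hfejer : ∀ y, (∀ j, y ∈ K j) → Antitone fun i => ‖x i - y‖ := fun y hy =>
    antitone_nat_of_succ_le fun i => by
      refine norm_sub_le_of_inner_nonpos ((hx (i + 1) (by omega)).2 y fun l hl _ j => ?_)
      have h1 := (hxp l (le_of_max_le_left hl) j).2 y (hy j)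
      rw [inner_sub_right] at h1
      linarith
  have hanti := hfejer xbar hq
  have hxpN : ∀ i j, x i - xp (i + 1) j ∈ normalCone (K j) (xp (i + 1) j) := fun i j =>
    (hxp (i + 1) (by omega) j).2
  have hxpK : ∀ i j, xp (i + 1) j ∈ K j := fun i j => (hxp (i + 1) (by omega) j).1
  have hxpq : ∀ i j, ‖xp (i + 1) j - xbar‖ ≤ ‖x i - xbar‖ := fun i j =>
    norm_sub_le_of_inner_nonpos (hxpN i j xbar (hq j))
  have hcut : ∀ l k, l < k → k ≤ l + pbar → ∀ j,
      ⟪x l - xp (l + 1) j, x k⟫ ≤ ⟪x l - xp (l + 1) j, xp (l + 1) j⟫ := fun l k hlk hkl j =>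
    (hx k (by omega)).1 (l + 1) (by omega) (by omega) j
  have hfar : ∀ i, ∃ j, ‖x i - xbar‖ < δ → ‖x i - xbar‖ ≤ C * ‖x i - xp (i + 1) j‖ := fun i => by
    by_cases hi : ‖x i - xbar‖ < δ
    · obtain ⟨y, hyK, j, hj⟩ := hreg (x i) hi
      refine ⟨j, fun _ => ?_⟩
      rw [infDist_eq_norm_sub_of_mem_normalCone (hKcv j) (hxpK i j) (hxpN i j)] at hj
      have h1 : ‖xbar - y‖ ≤ ‖x i - y‖ := le_of_tendsto (hlim.sub_const y).norm
        (eventually_atTop.2 ⟨i, fun k hk => hfejer y hyK hk⟩)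
      have h2 : ‖x i - xbar‖ ≤ ‖x i - y‖ + ‖xbar - y‖ := by
        rw [norm_sub_rev xbar y]
        exact norm_sub_le_norm_sub_add_norm_sub _ _ _
      linarith
    · exact ⟨⟨0, hr⟩, fun h => absurd h hi⟩
  choose J hJ using hfar
  set a : ℕ → EuclideanSpace ℝ (Fin n) := fun i => x i - xp (i + 1) (J i) with ha
  set u : ℕ → EuclideanSpace ℝ (Fin n) := fun i => ‖a i‖⁻¹ • a i with hu
  have he0 : Tendsto (fun i => ‖x i - xbar‖) atTop (𝓝 0) :=
    tendsto_iff_norm_sub_tendsto_zero.1 hlim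
  refine (tendsto_order.2 ⟨fun b hb => Eventually.of_forall fun i => hb.trans_le (by positivity),
    fun ρ hρ => ?_⟩)
  choose d hd hsupp using fun j => exists_inner_le_of_mem_normalCone (C := K j) xbar
    (ε := ρ * (C⁻¹ / 2)) (by positivity)
  have hev : ∀ᶠ i in atTop, ‖x i - xbar‖ < δ ∧ ∀ j, ‖x i - xbar‖ < d j :=
    (he0.eventually_lt_const hδ).and
      (eventually_all.2 fun j => he0.eventually_lt_const (hd j))
  obtain ⟨M, hM⟩ := eventually_atTop.1 hev
  filter_upwards [eventually_ge_atTop M] with m hm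
  rw [div_lt_iff₀ (hpos m)]
  by_contra! hcon
  have hapos : ∀ i, M ≤ i → 0 < ‖a i‖ := fun i hi =>
    pos_of_mul_pos_right ((hpos i).trans_le (hJ i (hM i hi).1)) hC0.le
  obtain ⟨l, k, hlk, hk, hlt⟩ := hP pbar hpbar (fun i => u (m + i)) fun i _ => by
    simp [hu, norm_smul, (hapos (m + i) (by omega)).ne']
  refine hlt.not_ge ?_
  have hsee : C⁻¹ * ‖x (m + k) - xbar‖ ≤ ⟪u (m + k), x (m + k) - xbar⟫ := by
    have h0 := hapos (m + k) (by omega)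
    have h1 : ‖a (m + k)‖ ^ 2 ≤ ⟪a (m + k), x (m + k) - xbar⟫ := by
      have h2 := hxpN (m + k) (J (m + k)) xbar (hq _)
      have h3 : x (m + k) - xbar =
          a (m + k) - (xbar - xp (m + k + 1) (J (m + k))) := by simp only [ha]; abel
      rw [h3, inner_sub_right, real_inner_self_eq_norm_sq]
      linarith
    simp only [hu, real_inner_smul_left]
    rw [inv_mul_le_iff₀ hC0, mul_left_comm, ← div_eq_inv_mul, le_div_iff₀ h0]
    nlinarith [hJ (m + k) (hM _ (by omega)).1]
  have hsmall : ⟪u (m + l), x (m + k) - xbar⟫ ≤ C⁻¹ / 2 * ‖x (m + k) - xbar‖ := by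
    have h0 := hapos (m + l) (by omega)
    have h1 : ⟪a (m + l), x (m + k) - xbar⟫ ≤
        ρ * (C⁻¹ / 2) * (‖a (m + l)‖ * ‖x (m + l) - xbar‖) := by
      have h2 := hsupp (J (m + l)) _ (hxpK (m + l) _)
        ((hxpq (m + l) _).trans_lt ((hM _ (by omega)).2 _)) _ (hxpN (m + l) _)
      have h3 := hcut (m + l) (m + k) (by omega) (by omega) (J (m + l))
      calc ⟪a (m + l), x (m + k) - xbar⟫
          ≤ ⟪a (m + l), xp (m + l + 1) (J (m + l)) - xbar⟫ := by
            rw [inner_sub_right, inner_sub_right]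
            exact sub_le_sub_right h3 _
        _ ≤ ρ * (C⁻¹ / 2) * (‖a (m + l)‖ * ‖xp (m + l + 1) (J (m + l)) - xbar‖) := h2
        _ ≤ _ := by
            gcongr
            exact hxpq _ _
    have h4 : ρ * ‖x (m + l) - xbar‖ ≤ ‖x (m + k) - xbar‖ :=
      calc ρ * ‖x (m + l) - xbar‖ ≤ ρ * ‖x m - xbar‖ :=
            mul_le_mul_of_nonneg_left (hanti (by omega)) hρ.le
        _ ≤ ‖x (m + pbar) - xbar‖ := hcon
        _ ≤ ‖x (m + k) - xbar‖ := hanti (by omega)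
    simp only [hu, real_inner_smul_left]
    rw [inv_mul_le_iff₀ h0]
    calc _ ≤ _ := h1
      _ = ‖a (m + l)‖ * (C⁻¹ / 2 * (ρ * ‖x (m + l) - xbar‖)) := by ring
      _ ≤ _ := by gcongr
  linarith [le_norm_sub_of_inner_le (hpos (m + k)) hsmall hsee]
end

section
/- Let K_1, …, K_r ⊆ ℝⁿ be nonempty closed convex sets, K := ⋂_{l=1}^r K_l, and x̄ ∈ K. Assume: (i) whenever v_l ∈ N_{K_l}(x̄) for l = 1,…,r and Σ_{l=1}^r v_l = 0, then v_l = 0 for all l; (ii) there exists ε̄ > 0 such that (K_l − x̄) ∩ B̄_ε̄(0) = T_{K_l}(x̄) ∩ B̄_ε̄(0) for all l = 1,…,r. Then there exists P ∈ ℕ such that for every integer p̄ ≥ P the following holds: if (x_i) is generated by the mass projection algorithm with memory p̄ — i.e. for i ≥ 1 and j ∈ {1,…,r}: x_i^{(j)} = P_{K_j}(x_{i−1}), a_i^{(j)} = x_{i−1} − x_i^{(j)}, b_i^{(j)} = ⟪a_i^{(j)}, x_i^{(j)}⟫, F̃_i = {x : ⟪a_l^{(j)}, x⟫ ≤ b_l^{(j)}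 for 1 ≤ j ≤ r and max(1, i−p̄) ≤ l ≤ i}, x_i = P_{F̃_i}(x_{i−1}) — and (x_i) converges to x̄, then the convergence is finite: x_i = x̄ for some i. -/
open scoped RealInnerProductSpace
open Filter Topology

/-- The tangent cone of a convex set `C` at a point `x̄ ∈ C`:
`closure (⋃_{t>0} t • (C - x̄))`. -/
def tangentConeCvx {E : Type*} [NormedAddCommGroup E] [InnerProductSpace ℝ E]
    (C : Set E) (x : E) : Set E :=
  closure {w | ∃ t : ℝ, 0 < t ∧ ∃ c ∈ C, w = t • (c - x)}

section

variable {E : Type*} [NormedAddCommGroup E] [InnerProductSpace ℝ E]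

theorem isClosed_tangentConeCvx (C : Set E) (x : E) : IsClosed (tangentConeCvx C x) :=
  isClosed_closure

theorem smul_mem_tangentConeCvx {C : Set E} {x w : E} {s : ℝ} (hs : 0 < s)
    (hw : w ∈ tangentConeCvx C x) : s • w ∈ tangentConeCvx C x := by
  refine map_mem_closure (continuous_const_smul s) hw ?_
  rintro _ ⟨t, ht, c, hc, rfl⟩
  exact ⟨s * t, mul_pos hs ht, c, hc, by rw [mul_smul]⟩

theorem sub_mem_tangentConeCvx {C : Set E} {x c : E} (hc : c ∈ C) :
    c - x ∈ tangentConeCvx C x :=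
  subset_closure ⟨1, one_pos, c, hc, by rw [one_smul]⟩

/-- If `C` agrees with its tangent cone near `x`, then the residual `y - p` of a projection onto
`C` of a point near `x` is orthogonal to `p - x` and polar to the tangent cone. -/
theorem residual_of_locally_conic {C : Set E} {x : E} (hx : x ∈ C) {ε : ℝ} (hε : 0 < ε)
    (hcone : ∀ w ∈ tangentConeCvx C x, ‖w‖ ≤ ε → w + x ∈ C) {y p : E} (hp : p ∈ C)
    (hproj : ∀ z ∈ C, ⟪y - p, z - p⟫ ≤ 0) (hy : ‖y - x‖ ≤ ε / 2) :
    ⟪y - p, p - x⟫ = 0 ∧ ∀ w ∈ tangentConeCvx C x, ⟪y - p, w⟫ ≤ 0 := by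
  have hge : 0 ≤ ⟪y - p, p - x⟫ := by
    have h := hproj x hx
    rw [← neg_sub p x, inner_neg_right] at h
    linarith
  have hnorm : ‖p - x‖ ≤ ‖y - x‖ := by
    have h1 : y - p = (y - x) - (p - x) := by abel
    rw [h1, inner_sub_left, real_inner_self_eq_norm_sq] at hge
    have h2 := real_inner_le_norm (y - x) (p - x)
    by_contra! hlt
    nlinarith [norm_nonneg (y - x)]
  have hle : ⟪y - p, p - x⟫ ≤ 0 := by
    have hmem : (2 : ℝ) • (p - x) + x ∈ C := by
      refine hcone _ (smul_mem_tangentConeCvx two_pos (sub_mem_tangentConeCvx hp)) ?_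
      rw [norm_smul, Real.norm_eq_abs, abs_two]
      linarith
    have h := hproj _ hmem
    rwa [show (2 : ℝ) • (p - x) + x - p = p - x by rw [two_smul]; abel] at h
  have hzero := le_antisymm hle hge
  refine ⟨hzero, fun w hw => ?_⟩
  have hpos : 0 < ε / (‖w‖ + 1) := by positivity
  have hmem : (ε / (‖w‖ + 1)) • w + x ∈ C := by
    refine hcone _ (smul_mem_tangentConeCvx hpos hw) ?_
    rw [norm_smul, Real.norm_of_nonneg hpos.le, div_mul_eq_mul_div, div_le_iff₀ (by positivity)]
    nlinarith
  have h := hproj _ hmem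
  rw [show (ε / (‖w‖ + 1)) • w + x - p = (ε / (‖w‖ + 1)) • w - (p - x) by abel,
    inner_sub_right, hzero, sub_zero, inner_smul_right] at h
  exact nonpos_of_mul_nonpos_right h hpos

/-- A unit vector polar to an intersection of finitely many closed sets stays away from at least
one of them, by a distance that does not depend on the vector. -/
theorem exists_pos_le_infDist_of_polar [ProperSpace E] {ι : Type*} [Fintype ι] (T : ι → Set E)
    (hTcl : ∀ j, IsClosed (T j)) (hTne : ∀ j, (T j).Nonempty) :
    ∃ δ : ℝ, 0 < δ ∧ ∀ u : E, ‖u‖ = 1 → (∀ t, (∀ j, t ∈ T j) → ⟪u, t⟫ ≤ 0) →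
      ∃ j, δ ≤ Metric.infDist u (T j) := by
  have hS : IsCompact (Metric.sphere (0 : E) 1 ∩ {u | ∀ t, (∀ j, t ∈ T j) → ⟪u, t⟫ ≤ 0}) := by
    refine (isCompact_sphere 0 1).inter_right ?_
    simp only [Set.ofPred_forall]
    exact isClosed_iInter fun t => isClosed_iInter fun _ =>
      isClosed_le (by fun_prop) continuous_const
  have hcont : Continuous fun u => ∑ j, Metric.infDist u (T j) :=
    continuous_finsetSum _ fun j _ => Metric.continuous_infDist_pt (T j)
  obtain ⟨δ, hδ, hmin⟩ := hS.exists_forall_le' hcont.continuousOn (a := 0) (by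
    rintro u ⟨hu, hpol⟩
    refine (Finset.sum_nonneg fun j _ => Metric.infDist_nonneg).lt_of_ne' fun h0 => ?_
    rw [Finset.sum_eq_zero_iff_of_nonneg fun j _ => Metric.infDist_nonneg] at h0
    have hself := hpol u fun j =>
      ((hTcl j).mem_iff_infDist_zero (hTne j)).2 (h0 j (Finset.mem_univ j))
    rw [real_inner_self_eq_norm_sq, mem_sphere_zero_iff_norm.1 hu] at hself
    norm_num at hself)
  refine ⟨δ / (Fintype.card ι + 1), by positivity, fun u hu hpol => ?_⟩
  by_contra! hlt
  have h1 := hmin u ⟨mem_sphere_zero_iff_norm.2 hu, hpol⟩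
  have h2 : ∑ j, Metric.infDist u (T j) ≤ Fintype.card ι * (δ / (Fintype.card ι + 1)) := by
    simpa using Finset.sum_le_card_nsmul Finset.univ _ _ fun j _ => (hlt j).le
  have h3 : (Fintype.card ι : ℝ) * (δ / (Fintype.card ι + 1)) < δ := by
    rw [mul_div_assoc', div_lt_iff₀ (by positivity)]
    nlinarith
  linarith

/-- Among sufficiently many unit vectors of a proper space, two are close to each other. -/
theorem exists_dist_lt_of_norm_eq_one {E : Type*} [NormedAddCommGroup E] [ProperSpace E]
    {δ : ℝ} (hδ : 0 < δ) :
    ∃ N : ℕ, ∀ u : ℕ → E, (∀ i, ‖u i‖ = 1) → ∃ l m, l < m ∧ m ≤ N ∧ dist (u l) (u m) < δ := by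
  obtain ⟨s, -, hfin, hcov⟩ := (isCompact_sphere (0 : E) 1).finite_cover_balls (half_pos hδ)
  refine ⟨hfin.toFinset.card, fun u hu => ?_⟩
  have hc : ∀ i, ∃ c ∈ s, dist (u i) c < δ / 2 := fun i => by
    simpa using hcov (mem_sphere_zero_iff_norm.2 (hu i))
  choose c hcs hcd using hc
  obtain ⟨l, hl, m, hm, hne, heq⟩ := Finset.exists_ne_map_eq_of_card_lt_of_maps_to
    (s := Finset.range (hfin.toFinset.card + 1)) (t := hfin.toFinset) (f := c) (by simp)
    (fun i _ => by simpa using hcs i)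
  have hdist : dist (u l) (u m) < δ := by
    have h1 := dist_triangle_right (u l) (u m) (c l)
    have h2 := hcd l
    have h3 := hcd m
    rw [← heq] at h3
    linarith
  rw [Finset.mem_range, Nat.lt_succ_iff] at hl hm
  rcases hne.lt_or_gt with h | h
  · exact ⟨l, m, h, hm, hdist⟩
  · exact ⟨m, l, h, hl, by rwa [dist_comm]⟩

/-- A vector `y` is at most as far from a cone containing `p`, relative to its norm, as its
direction is from the direction of any `y'` cut off by the hyperplane through `p` orthogonal to
the residual `y - p`. -/
theorem infDist_normalize_le {T : Set E} (hT : ∀ s : ℝ, 0 < s → ∀ w ∈ T, s • w ∈ T)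
    {y y' p : E} (hp : p ∈ T) (hy : y ≠ 0) (hy' : y' ≠ 0) (horth : ⟪y - p, p⟫ = 0)
    (hcut : ⟪y - p, y'⟫ ≤ 0) :
    Metric.infDist (‖y‖⁻¹ • y) T ≤ dist (‖y‖⁻¹ • y) (‖y'‖⁻¹ • y') := by
  have hpos : 0 < ‖y‖⁻¹ := inv_pos.2 (norm_pos_iff.2 hy)
  have hpos' : 0 < ‖y'‖⁻¹ := inv_pos.2 (norm_pos_iff.2 hy')
  refine (Metric.infDist_le_dist_of_mem (hT _ hpos p hp)).trans ?_
  rw [dist_eq_norm, dist_eq_norm, ← smul_sub, norm_smul, Real.norm_of_nonneg hpos.le]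
  have h1 : ⟪y - p, ‖y‖⁻¹ • y - ‖y'‖⁻¹ • y'⟫ ≥ ‖y‖⁻¹ * ‖y - p‖ ^ 2 := by
    have h2 : ⟪y - p, y⟫ = ‖y - p‖ ^ 2 := by
      rw [← real_inner_self_eq_norm_sq, inner_sub_right (y - p) y p, horth, sub_zero]
    rw [inner_sub_right, inner_smul_right, inner_smul_right, h2]
    nlinarith
  have h2 := real_inner_le_norm (y - p) (‖y‖⁻¹ • y - ‖y'‖⁻¹ • y')
  rcases (norm_nonneg (y - p)).eq_or_lt with h0 | h0
  · rw [← h0, mul_zero]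
    exact norm_nonneg _
  · refine le_of_mul_le_mul_left ?_ h0
    nlinarith

end

/-- Finite convergence of the mass projection algorithm under the
normal cone alignment condition and a local conic structure at `x̄` (Theorem 5.12). -/
theorem finite_convergence_mass_projection
    {n : ℕ} {r : ℕ} (hr : 1 ≤ r)
    (K : Fin r → Set (EuclideanSpace ℝ (Fin n)))
    (hKne : ∀ j, (K j).Nonempty) (hKcl : ∀ j, IsClosed (K j))
    (hKcv : ∀ j, Convex ℝ (K j))
    (xbar : EuclideanSpace ℝ (Fin n)) (hxbar : xbar ∈ ⋂ j, K j)
    -- (i) alignment condition on the normal cones at `x̄`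
    (hcond : ∀ v : Fin r → EuclideanSpace ℝ (Fin n),
      (∀ l, v l ∈ normalCone (K l) xbar) → ∑ l, v l = 0 → ∀ l, v l = 0)
    -- (ii) local conic structure: `(K_l − x̄) ∩ B̄_ε̄(0) = T_{K_l}(x̄) ∩ B̄_ε̄(0)`
    (εbar : ℝ) (hεbar : 0 < εbar)
    (hcone : ∀ l, ((· - xbar) '' K l) ∩ Metric.closedBall 0 εbar =
      tangentConeCvx (K l) xbar ∩ Metric.closedBall 0 εbar) :
    ∃ P : ℕ, ∀ pbar : ℕ, P ≤ pbar →
      ∀ (x : ℕ → EuclideanSpace ℝ (Fin n))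
        (xp : ℕ → Fin r → EuclideanSpace ℝ (Fin n)),
        -- `xp i j = P_{K j}(x (i-1))`
        (∀ i, 1 ≤ i → ∀ j, xp i j ∈ K j ∧
          ∀ z ∈ K j, ⟪x (i - 1) - xp i j, z - xp i j⟫ ≤ 0) →
        -- `x i = P_{F̃ i}(x (i-1))`
        (∀ i, 1 ≤ i →
          (∀ l, max 1 (i - pbar) ≤ l → l ≤ i → ∀ j,
            ⟪x (l - 1) - xp l j, x i⟫ ≤ ⟪x (l - 1) - xp l j, xp l j⟫) ∧
          ∀ z : EuclideanSpace ℝ (Fin n),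
            (∀ l, max 1 (i - pbar) ≤ l → l ≤ i → ∀ j,
              ⟪x (l - 1) - xp l j, z⟫ ≤ ⟪x (l - 1) - xp l j, xp l j⟫) →
            ⟪x (i - 1) - x i, z - x i⟫ ≤ 0) →
        Tendsto x atTop (𝓝 xbar) →
        ∃ i, x i = xbar := by
  have hxb : ∀ j, xbar ∈ K j := Set.mem_iInter.1 hxbar
  have hloc : ∀ j, ∀ w ∈ tangentConeCvx (K j) xbar, ‖w‖ ≤ εbar → w + xbar ∈ K j := by
    intro j w hw hwn
    have hmem : w ∈ tangentConeCvx (K j) xbar ∩ Metric.closedBall 0 εbar :=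
      ⟨hw, mem_closedBall_zero_iff.2 hwn⟩
    rw [← hcone j] at hmem
    obtain ⟨⟨c, hc, rfl⟩, -⟩ := hmem
    simpa using hc
  obtain ⟨δ, hδ, hfar⟩ := exists_pos_le_infDist_of_polar
    (fun j => tangentConeCvx (K j) xbar) (fun j => isClosed_tangentConeCvx _ _)
    (fun j => ⟨_, sub_mem_tangentConeCvx (hxb j)⟩)
  obtain ⟨N, hN⟩ := exists_dist_lt_of_norm_eq_one (E := EuclideanSpace ℝ (Fin n)) hδ
  refine ⟨N, fun pbar hpbar x xp hxp hx hlim => ?_⟩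
  by_contra! hne
  obtain ⟨M, hM⟩ := Metric.tendsto_atTop.1 hlim (εbar / 2) (half_pos hεbar)
  have hres : ∀ l, M + 1 ≤ l → ∀ j, ⟪x (l - 1) - xp l j, xp l j - xbar⟫ = 0 ∧
      ∀ w ∈ tangentConeCvx (K j) xbar, ⟪x (l - 1) - xp l j, w⟫ ≤ 0 := by
    intro l hl j
    obtain ⟨hmem, hproj⟩ := hxp l (by omega) j
    refine residual_of_locally_conic (hxb j) hεbar (hloc j) hmem hproj ?_
    rw [← dist_eq_norm]
    exact (hM _ (by omega)).le
  have hstep : ∀ i, M + 1 + pbar ≤ i → ∀ t, (∀ j, t ∈ tangentConeCvx (K j) xbar) →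
      ⟪x (i - 1) - x i, t⟫ ≤ 0 := by
    intro i hi t ht
    obtain ⟨hfeas, hproj⟩ := hx i (by omega)
    have h := hproj (x i + t) fun l hl hli j => by
      rw [inner_add_right]
      have h1 := hfeas l hl hli j
      have h2 := (hres l (by omega) j).2 t (ht j)
      linarith
    rwa [add_sub_cancel_left] at h
  have hpolar : ∀ i, M + pbar ≤ i → ∀ t, (∀ j, t ∈ tangentConeCvx (K j) xbar) →
      ⟪x i - xbar, t⟫ ≤ 0 := by
    intro i hi t ht
    have hmono : Monotone fun k => ⟪x (k + i) - xbar, t⟫ := by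
      refine monotone_nat_of_le_succ fun k => ?_
      have h := hstep (k + 1 + i) (by omega) t ht
      rw [show k + 1 + i - 1 = k + i by omega, ← sub_sub_sub_cancel_right _ _ xbar,
        inner_sub_left] at h
      linarith
    have htend : Tendsto (fun k => ⟪x (k + i) - xbar, t⟫) atTop (𝓝 0) := by
      have h := (((tendsto_add_atTop_iff_nat i).2 hlim).sub_const xbar).inner
        (𝕜 := ℝ) (tendsto_const_nhds (x := t))
      simpa using h
    simpa using hmono.ge_of_tendsto htend 0
  have hyne : ∀ i, x i - xbar ≠ 0 := fun i => sub_ne_zero.2 (hne i)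
  obtain ⟨l, m, hlm, hmN, hdist⟩ := hN
    (fun k => ‖x (M + pbar + k) - xbar‖⁻¹ • (x (M + pbar + k) - xbar))
    (fun k => norm_smul_inv_norm (𝕜 := ℝ) (hyne _))
  set L := M + pbar + l with hL
  set R := M + pbar + m with hR
  obtain ⟨j, hj⟩ := hfar (‖x L - xbar‖⁻¹ • (x L - xbar))
    (norm_smul_inv_norm (𝕜 := ℝ) (hyne _)) fun t ht => by
      rw [inner_smul_left]
      exact mul_nonpos_of_nonneg_of_nonpos (by simp) (hpolar L (by omega) t ht)
  refine (hj.trans ?_).not_gt hdist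
  have hresL := (hres (L + 1) (by omega) j).1
  have hcut := (hx R (by omega)).1 (L + 1) (by omega) (by omega) j
  rw [Nat.add_sub_cancel] at hresL hcut
  refine infDist_normalize_le (fun s hs w hw => smul_mem_tangentConeCvx hs hw)
    (sub_mem_tangentConeCvx (hxp (L + 1) (by omega) j).1) (hyne L) (hyne R) ?_ ?_
  · rwa [sub_sub_sub_cancel_right]
  · rw [sub_sub_sub_cancel_right]
    rw [inner_sub_right] at hresL ⊢
    linarith
end

section
/- Let K_1, …, K_r ⊆ ℝⁿ be nonempty closed convex sets with ⋂_{l=1}^r K_l = ∅, and let x_0 ∈ ℝⁿ. Suppose the sequences (x_i), (x_i^{(j)}) satisfy, for all i ≥ 1 and j ∈ {1,…,r}: x_i^{(j)} = P_{K_j}(x_{i−1}), x_i ∈ F_i := {x : ⟪x_{l−1} − x_l^{(j)}, x⟫ ≤ ⟪x_{l−1} − x_l^{(j)}, x_l^{(j)}⟫ for all 1 ≤ l ≤ i, 1 ≤ j ≤ r}, and x_i ≠ 0 for all i. Then every cluster point v of the normalized sequence (x_i/‖x_i‖) belongs to the recession cone R(K_l) for every l = 1,…,r. -/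
open scoped RealInnerProductSpace
open Filter Topology

section Cutters

variable {E : Type*} [NormedAddCommGroup E] [InnerProductSpace ℝ E]

/-- The distance from `a` to its projection `p` is at most the distance from `a` to any point `b`
of the half-space cut out at `p` by `a - p`. -/
lemma norm_sub_le_of_inner_le_inner {a p b : E} (h : ⟪a - p, b⟫ ≤ ⟪a - p, p⟫) :
    ‖a - p‖ ≤ ‖a - b‖ := by
  have h1 : ‖a - p‖ * ‖a - p‖ ≤ ‖a - p‖ * ‖a - b‖ := by
    rw [← real_inner_self_eq_norm_mul_norm]
    refine le_trans ?_ (real_inner_le_norm _ _)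
    rw [inner_sub_right, inner_sub_right]
    linarith
  rcases (norm_nonneg (a - p)).eq_or_lt with h0 | h0
  · rw [← h0]
    exact norm_nonneg _
  · exact le_of_mul_le_mul_left h1 h0

/-- If every later term `x m` lies in the half-spaces cut out at the points `p i j ∈ K j` by
`x i - p i j`, and the closed sets `K j` have no common point, then `‖x i‖ → ∞`. -/
lemma tendsto_norm_atTop_of_iInter_eq_empty [ProperSpace E] {ι : Type*} {K : ι → Set E}
    (hKcl : ∀ j, IsClosed (K j)) (hK : ⋂ j, K j = ∅) {x : ℕ → E} {p : ℕ → ι → E}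
    (hp : ∀ i j, p i j ∈ K j)
    (hcut : ∀ i m, i < m → ∀ j, ⟪x i - p i j, x m⟫ ≤ ⟪x i - p i j, p i j⟫) :
    Tendsto (fun i => ‖x i‖) atTop atTop := by
  by_contra hcon
  obtain ⟨C, hC⟩ : ∃ C, ∃ᶠ i in atTop, x i ∈ Metric.closedBall (0 : E) C := by
    simp only [tendsto_atTop, not_forall] at hcon
    obtain ⟨C, hC⟩ := hcon
    refine ⟨C, (not_eventually.mp hC).mono fun i hi => ?_⟩
    simpa using (not_le.mp hi).le
  obtain ⟨a, -, φ, hφ, ha⟩ := tendsto_subseq_of_frequently_bounded Metric.isBounded_closedBall hC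
  have hmem : a ∈ ⋂ j, K j := by
    refine Set.mem_iInter.mpr fun j => ?_
    have hdiff : Tendsto (fun k => x (φ k) - p (φ k) j) atTop (𝓝 0) := by
      refine squeeze_zero_norm (a := fun k => ‖x (φ k) - x (φ (k + 1))‖)
        (fun k => norm_sub_le_of_inner_le_inner (hcut _ _ (hφ k.lt_succ_self) j)) ?_
      simpa using (ha.sub (ha.comp (tendsto_add_atTop_nat 1))).norm
    have hlim : Tendsto (fun k => p (φ k) j) atTop (𝓝 a) := by
      simpa using ha.sub hdiff
    exact (hKcl j).mem_of_tendsto hlim (Eventually.of_forall fun k => hp _ j)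
  simp [hK] at hmem

/-- A half-space that contains an unbounded sequence from some point on has every limiting
direction of this sequence in its recession cone. -/
lemma inner_nonpos_of_tendsto_direction {u v : E} {c : ℝ} {z : ℕ → E}
    (hz : Tendsto (fun k => ‖z k‖) atTop atTop)
    (hv : Tendsto (fun k => ‖z k‖⁻¹ • z k) atTop (𝓝 v))
    (hc : ∀ᶠ k in atTop, ⟪u, z k⟫ ≤ c) : ⟪u, v⟫ ≤ 0 := by
  have h1 : Tendsto (fun k => ⟪u, ‖z k‖⁻¹ • z k⟫) atTop (𝓝 ⟪u, v⟫) :=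
    tendsto_const_nhds.inner hv
  have h2 : Tendsto (fun k => ‖z k‖⁻¹ * c) atTop (𝓝 0) := by
    simpa using hz.inv_tendsto_atTop.mul_const c
  refine le_of_tendsto_of_tendsto h1 h2 (hc.mono fun k hk => ?_)
  simp only [real_inner_smul_right]
  exact mul_le_mul_of_nonneg_left hk (inv_nonneg.mpr (norm_nonneg _))

/-- If the points `q k` lie in a closed convex set and `s k → ∞`, then the limit of
`(s k)⁻¹ • q k` is a recession direction of the set. -/
lemma add_smul_mem_of_tendsto_inv_smul {C : Set E} (hcl : IsClosed C) (hcv : Convex ℝ C)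
    {s : ℕ → ℝ} {q : ℕ → E} {v : E} (hs : Tendsto s atTop atTop) (hq : ∀ k, q k ∈ C)
    (hv : Tendsto (fun k => (s k)⁻¹ • q k) atTop (𝓝 v)) {y : E} (hy : y ∈ C) {t : ℝ}
    (ht : 0 ≤ t) : y + t • v ∈ C := by
  have hts : Tendsto (fun k => t * (s k)⁻¹) atTop (𝓝 0) := by
    simpa using hs.inv_tendsto_atTop.const_mul t
  have hlim : Tendsto (fun k => (1 - t * (s k)⁻¹) • y + (t * (s k)⁻¹) • q k) atTop
      (𝓝 (y + t • v)) := by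
    have h1 : Tendsto (fun k => (1 - t * (s k)⁻¹) • y) atTop (𝓝 y) := by
      simpa using (hts.const_sub 1).smul_const y
    simpa only [mul_smul] using h1.add (hv.const_smul t)
  refine hcl.mem_of_tendsto hlim ?_
  filter_upwards [hts.eventually (eventually_le_nhds zero_lt_one), hs.eventually_ge_atTop 0]
    with k hk hsk
  exact hcv hy (hq k) (by linarith) (mul_nonneg ht (inv_nonneg.mpr hsk)) (by ring)

end Cutters

/-- (Theorem 6.2, Recession directions.) In the infeasible case in
`ℝⁿ`, every cluster point of the normalized iterates `x_i / ‖x_i‖` lies in the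
recession cone of every `K l`. -/
theorem cluster_points_in_recession_cones
    {n : ℕ} {r : ℕ} (hr : 1 ≤ r)
    (K : Fin r → Set (EuclideanSpace ℝ (Fin n)))
    (hKne : ∀ j, (K j).Nonempty) (hKcl : ∀ j, IsClosed (K j))
    (hKcv : ∀ j, Convex ℝ (K j))
    (hK : ⋂ j, K j = ∅)
    (x0 : EuclideanSpace ℝ (Fin n))
    (x : ℕ → EuclideanSpace ℝ (Fin n))
    (xp : ℕ → Fin r → EuclideanSpace ℝ (Fin n))
    (hx0 : x 0 = x0)
    -- `xp i j = P_{K j}(x (i-1))`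
    (hproj : ∀ i, 1 ≤ i → ∀ j, xp i j ∈ K j ∧
      ∀ z ∈ K j, ⟪x (i - 1) - xp i j, z - xp i j⟫ ≤ 0)
    -- `x i ∈ F i`
    (hxF : ∀ i, 1 ≤ i → ∀ l, 1 ≤ l → l ≤ i → ∀ j,
      ⟪x (l - 1) - xp l j, x i⟫ ≤ ⟪x (l - 1) - xp l j, xp l j⟫)
    (hne : ∀ i, x i ≠ 0) :
    ∀ v : EuclideanSpace ℝ (Fin n),
      (∃ ik : ℕ → ℕ, StrictMono ik ∧
        Tendsto (fun k => (‖x (ik k)‖)⁻¹ • x (ik k)) atTop (𝓝 v)) →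
      ∀ l, ∀ y ∈ K l, ∀ t : ℝ, 0 ≤ t → y + t • v ∈ K l := by
  rintro v ⟨φ, hφ, hv⟩ l y hy t ht
  have hcut : ∀ i m, i < m → ∀ j,
      ⟪x i - xp (i + 1) j, x m⟫ ≤ ⟪x i - xp (i + 1) j, xp (i + 1) j⟫ := fun i m him j => by
    simpa using hxF m (by omega) (i + 1) (by omega) him j
  have hp : ∀ i j, xp (i + 1) j ∈ K j := fun i j => (hproj (i + 1) (by omega) j).1
  have hnorm : Tendsto (fun k => ‖x (φ k)‖) atTop atTop :=
    (tendsto_norm_atTop_of_iInter_eq_empty (p := fun i j => xp (i + 1) j)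
      hKcl hK hp hcut).comp hφ.tendsto_atTop
  have hnonpos : ∀ i, ⟪x i - xp (i + 1) l, v⟫ ≤ 0 := fun i =>
    inner_nonpos_of_tendsto_direction hnorm hv
      ((hφ.tendsto_atTop.eventually_gt_atTop i).mono fun k hk => hcut i _ hk l)
  have hdist : ∀ k, ‖x (φ k) - xp (φ k + 1) l‖ ≤ ‖x (φ k) - (y + ‖x (φ k)‖ • v)‖ := fun k => by
    have h1 := (hproj (φ k + 1) (by omega) l).2 y hy
    have h2 := mul_nonpos_of_nonneg_of_nonpos (norm_nonneg (x (φ k))) (hnonpos (φ k))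
    apply norm_sub_le_of_inner_le_inner
    rw [Nat.add_sub_cancel, inner_sub_right] at h1
    rw [inner_add_right, real_inner_smul_right]
    linarith
  have hgap : Tendsto (fun k => ‖x (φ k)‖⁻¹ • (x (φ k) - xp (φ k + 1) l)) atTop (𝓝 0) := by
    refine squeeze_zero_norm
      (a := fun k => ‖‖x (φ k)‖⁻¹ • x (φ k) - (‖x (φ k)‖⁻¹ • y + v)‖) (fun k => ?_) ?_
    · have h0 : ‖x (φ k)‖ ≠ 0 := norm_ne_zero_iff.mpr (hne _)
      have h1 : ‖x (φ k)‖⁻¹ • x (φ k) - (‖x (φ k)‖⁻¹ • y + v) =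
          ‖x (φ k)‖⁻¹ • (x (φ k) - (y + ‖x (φ k)‖ • v)) := by
        rw [smul_sub, smul_add, inv_smul_smul₀ h0]
      rw [h1, norm_smul, norm_smul]
      exact mul_le_mul_of_nonneg_left (hdist k) (norm_nonneg _)
    · simpa using (hv.sub ((hnorm.inv_tendsto_atTop.smul_const y).add_const v)).norm
  refine add_smul_mem_of_tendsto_inv_smul (hKcl l) (hKcv l) hnorm (fun k => hp (φ k) l) ?_ hy ht
  simpa [smul_sub] using hv.sub hgap
end
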